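/- arXiv:1110.5080 — 3 statements merged into one kernel-verified Lean document; each statement's English description precedes it below -/
import Mathlib

section
/- Property (P): let M be a multisegment and k ≥ 1. If there exists a segment S of length k such that every element of E(M) belongs to S, then every segment of M^# has length at most k, i.e., m(M^#) ≤ k. -/
open scoped Classical

noncomputable section

/-- The segment `{a, a+1, ..., a+m-1}` as a finite set of reals. -/
def finsetSeg (a : ℝ) (m : ℕ) : Finset ℝ :=
  (Finset.range m).image (fun i => a + i)

/-- A segment is a nonempty subset of `ℝ` of the form `{a, a+1, ..., a+m-1}` with `m ≥ 1`. -/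
def IsSegment (S : Finset ℝ) : Prop :=
  ∃ (a : ℝ) (m : ℕ), 1 ≤ m ∧ S = finsetSeg a m

/-- A multisegment is a nonempty finite multiset of segments. -/
def IsMultisegment (M : Multiset (Finset ℝ)) : Prop :=
  M ≠ 0 ∧ ∀ S ∈ M, IsSegment S

/-- The beginning (smallest element) of a segment. -/
def beg (S : Finset ℝ) : ℝ := if h : S.Nonempty then S.min' h else 0

/-- The ending (largest element) of a segment. -/
def endg (S : Finset ℝ) : ℝ := if h : S.Nonempty then S.max' h else 0

/-- Two segments are linked if neither is included in the other and their union is a segment. -/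
def Linked (S₁ S₂ : Finset ℝ) : Prop :=
  ¬ S₁ ⊆ S₂ ∧ ¬ S₂ ⊆ S₁ ∧ IsSegment (S₁ ∪ S₂)

/-- `ElemOp M N` means that `N` is obtained from `M` by an elementary operation:
a pair of linked segments `S₁, S₂` of `M` is replaced by `S₁ ∪ S₂, S₁ ∩ S₂`,
the intersection being omitted when empty. -/
def ElemOp (M N : Multiset (Finset ℝ)) : Prop :=
  ∃ (S₁ S₂ : Finset ℝ) (rest : Multiset (Finset ℝ)),
    Linked S₁ S₂ ∧ M = S₁ ::ₘ S₂ ::ₘ rest ∧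
    N = (if S₁ ∩ S₂ = ∅ then (S₁ ∪ S₂) ::ₘ rest
         else (S₁ ∪ S₂) ::ₘ (S₁ ∩ S₂) ::ₘ rest)

/-- `msLE M M'` (i.e. `M ≤ M'`) : `M` is obtained from `M'` by a finite (possibly empty)
sequence of elementary operations. -/
def msLE (M M' : Multiset (Finset ℝ)) : Prop :=
  Relation.ReflTransGen ElemOp M' M

/-- The support of a multisegment: the multiset union of its segments. -/
def suppM (M : Multiset (Finset ℝ)) : Multiset ℝ :=
  (M.map Finset.val).sum

/-- The maxlength `m(M)`: the maximal length of the segments of `M`. -/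
def maxLen (M : Multiset (Finset ℝ)) : ℕ :=
  (M.map Finset.card).sup

/-- The thickness `t(M)`: the number of segments of `M`, counted with multiplicity. -/
def thickness (M : Multiset (Finset ℝ)) : ℕ := Multiset.card M

/-- The largest element of `E(M)`, the multiset of endings of the segments of `M`. -/
def maxEnd (M : Multiset (Finset ℝ)) : ℝ :=
  ((M.map endg).toFinset.max).unbotD 0

/-- The candidate segments of `M` with ending `x` which are not included in `prev`. -/
def cands (M : Multiset (Finset ℝ)) (x : ℝ) (prev : Finset ℝ) : Finset (Finset ℝ) :=
  M.toFinset.filter (fun S => endg S = x ∧ ¬ S ⊆ prev)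

/-- A shortest element of a finite collection of finite sets (junk value `∅` if empty).
In the Moeglin-Waldspurger algorithm the candidate sets consist of segments with a
common ending, so a shortest candidate is unique and this choice is canonical. -/
def chooseMin (C : Finset (Finset ℝ)) : Finset ℝ :=
  if h : C.Nonempty then (Finset.exists_min_image C Finset.card h).choose else ∅

/-- The chain `δ₀, δ₁, δ₂, ...` of the Moeglin-Waldspurger algorithm: `δ₀` is a shortest
segment of `M` with ending `x` (the maximal ending), and `δ_i` is a shortest segment of
`M` with ending `x - i` not included in `δ_{i-1}`; the construction stops when no such
segment exists.  The first argument is fuel (the chain has length at most `card M`). -/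
def mwChainAux (M : Multiset (Finset ℝ)) : ℕ → ℝ → Finset ℝ → List (Finset ℝ)
  | 0, _, _ => []
  | n + 1, x, prev =>
      if (cands M x prev).Nonempty then
        chooseMin (cands M x prev) :: mwChainAux M n (x - 1) (chooseMin (cands M x prev))
      else []

/-- The chain `δ₀, δ₁, ..., δ_r` of the Moeglin-Waldspurger algorithm for `M`. -/
def mwChain (M : Multiset (Finset ℝ)) : List (Finset ℝ) :=
  mwChainAux M (Multiset.card M) (maxEnd M) ∅

/-- The first segment `S₀ = {e-r, ..., e}` of `M^#`, where `e = maxEnd M` and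
`r + 1` is the length of the chain. -/
def firstSeg (M : Multiset (Finset ℝ)) : Finset ℝ :=
  finsetSeg (maxEnd M - (((mwChain M).length - 1 : ℕ) : ℝ)) (mwChain M).length

/-- `δ⁻`: the segment `δ` with its ending removed. -/
def segMinus (S : Finset ℝ) : Finset ℝ := S.erase (endg S)

/-- `M⁻`: the multisegment obtained from `M` by replacing each `δ_i` of the chain by
`δ_i⁻`, erasing it if it becomes empty. -/
def msMinus (M : Multiset (Finset ℝ)) : Multiset (Finset ℝ) :=
  (mwChain M).foldl
    (fun N δ => if segMinus δ = ∅ then N.erase δ else segMinus δ ::ₘ N.erase δ) M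

/-- Fuelled version of the Moeglin-Waldspurger algorithm.  Each round extracts the first
segment `S₀` and recurses on `M⁻`; on a genuine multisegment each round strictly decreases
the cardinality of the support, so fuel `card (suppM M)` always suffices. -/
def mwaAux : ℕ → Multiset (Finset ℝ) → Multiset (Finset ℝ)
  | 0, _ => 0
  | n + 1, M => if M = 0 then 0 else firstSeg M ::ₘ mwaAux n (msMinus M)

/-- The Moeglin-Waldspurger algorithm `M ↦ M^#`. -/
def mwa (M : Multiset (Finset ℝ)) : Multiset (Finset ℝ) :=
  mwaAux (Multiset.card (suppM M)) M

/-- The staircase multisegment `M(a; l, k)`: the `k` segments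
`{a+i, a+i+1, ..., a+i+l-1}` for `i = 1, ..., k` (`k` segments of length `l`,
each a shift by `1` of the previous one). -/
def staircase (a : ℝ) (l k : ℕ) : Multiset (Finset ℝ) :=
  (Multiset.range k).map (fun i => finsetSeg (a + i + 1) l)

theorem mem_finsetSeg {a x : ℝ} {m : ℕ} : x ∈ finsetSeg a m ↔ ∃ i < m, a + (i : ℝ) = x := by
  simp only [finsetSeg, Finset.mem_image, Finset.bind_def, Finset.pure_def, Finset.mem_sup,
    Finset.mem_singleton, Finset.mem_range]
  constructor
  · rintro ⟨_, ⟨i, hi, rfl⟩, rfl⟩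
    exact ⟨i, hi, rfl⟩
  · rintro ⟨i, hi, rfl⟩
    exact ⟨i, ⟨i, hi, rfl⟩, rfl⟩

theorem card_finsetSeg (a : ℝ) (m : ℕ) : (finsetSeg a m).card = m := by
  have h : finsetSeg a m = (Finset.range m).image (fun i : ℕ => a + (i : ℝ)) := by
    ext x
    simp [mem_finsetSeg]
  rw [h, Finset.card_image_of_injective, Finset.card_range]
  intro i j hij
  simpa using hij

theorem endg_eq_of_isGreatest {S : Finset ℝ} {x : ℝ} (hx : x ∈ S) (h : ∀ y ∈ S, y ≤ x) :
    endg S = x := by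
  rw [endg, dif_pos ⟨x, hx⟩]
  exact le_antisymm (Finset.max'_le _ _ _ h) (Finset.le_max' _ _ hx)

theorem endg_finsetSeg_succ (a : ℝ) (m : ℕ) : endg (finsetSeg a (m + 1)) = a + m := by
  refine endg_eq_of_isGreatest (mem_finsetSeg.2 ⟨m, m.lt_succ_self, rfl⟩) ?_
  intro y hy
  obtain ⟨i, hi, rfl⟩ := mem_finsetSeg.1 hy
  have : (i : ℝ) ≤ m := by exact_mod_cast Nat.lt_succ_iff.1 hi
  linarith

theorem segMinus_finsetSeg_succ (a : ℝ) (m : ℕ) :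
    segMinus (finsetSeg a (m + 1)) = finsetSeg a m := by
  ext x
  rw [segMinus, endg_finsetSeg_succ, Finset.mem_erase, mem_finsetSeg, mem_finsetSeg]
  constructor
  · rintro ⟨hne, i, hi, rfl⟩
    refine ⟨i, lt_of_le_of_ne (Nat.lt_succ_iff.1 hi) ?_, rfl⟩
    rintro rfl
    exact hne rfl
  · rintro ⟨i, hi, rfl⟩
    refine ⟨fun h => hi.ne ?_, i, hi.trans m.lt_succ_self, rfl⟩
    exact_mod_cast add_left_cancel h

namespace IsSegment

theorem exists_eq_succ {S : Finset ℝ} (hS : IsSegment S) :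
    ∃ (a : ℝ) (m : ℕ), S = finsetSeg a (m + 1) := by
  obtain ⟨a, m, hm, rfl⟩ := hS
  obtain ⟨m, rfl⟩ := Nat.exists_eq_add_of_le' hm
  exact ⟨a, m, rfl⟩

theorem not_subset_empty {S : Finset ℝ} (hS : IsSegment S) : ¬ S ⊆ ∅ := by
  obtain ⟨a, m, rfl⟩ := hS.exists_eq_succ
  exact fun h => Finset.notMem_empty _ (h (mem_finsetSeg.2 ⟨0, m.succ_pos, rfl⟩))

theorem segMinus_spec {S : Finset ℝ} (hS : IsSegment S) (h : segMinus S ≠ ∅) :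
    IsSegment (segMinus S) ∧ endg (segMinus S) = endg S - 1 := by
  obtain ⟨a, m, rfl⟩ := hS.exists_eq_succ
  rw [segMinus_finsetSeg_succ] at h ⊢
  obtain _ | m := m
  · simp [finsetSeg] at h
  · refine ⟨⟨a, m + 1, by omega, rfl⟩, ?_⟩
    rw [endg_finsetSeg_succ, endg_finsetSeg_succ]
    push_cast
    ring

theorem subset_of_card_le {S T : Finset ℝ} (hS : IsSegment S) (hT : IsSegment T)
    (he : endg S = endg T) (hc : S.card ≤ T.card) : S ⊆ T := by
  obtain ⟨a, m, rfl⟩ := hS.exists_eq_succ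
  obtain ⟨b, n, rfl⟩ := hT.exists_eq_succ
  rw [card_finsetSeg, card_finsetSeg] at hc
  rw [endg_finsetSeg_succ, endg_finsetSeg_succ] at he
  obtain ⟨d, hd⟩ := Nat.exists_eq_add_of_le' hc
  have hd' : (n : ℝ) = d + m := by exact_mod_cast (by omega : n = d + m)
  intro x hx
  obtain ⟨i, hi, rfl⟩ := mem_finsetSeg.1 hx
  refine mem_finsetSeg.2 ⟨d + i, by omega, ?_⟩
  push_cast
  linarith

end IsSegment

theorem mem_cands {M : Multiset (Finset ℝ)} {x : ℝ} {p S : Finset ℝ} :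
    S ∈ cands M x p ↔ S ∈ M ∧ endg S = x ∧ ¬ S ⊆ p := by
  simp [cands]

theorem chooseMin_mem {C : Finset (Finset ℝ)} (h : C.Nonempty) : chooseMin C ∈ C := by
  rw [chooseMin, dif_pos h]
  exact (Finset.exists_min_image C Finset.card h).choose_spec.1

theorem card_chooseMin_le {C : Finset (Finset ℝ)} {S : Finset ℝ} (hS : S ∈ C) :
    (chooseMin C).card ≤ S.card := by
  have h : C.Nonempty := ⟨S, hS⟩
  rw [chooseMin, dif_pos h]
  exact (Finset.exists_min_image C Finset.card h).choose_spec.2 S hS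

/-- The `i`-th element of the chain is a candidate relative to its predecessor. -/
theorem mwChainAux_getD_mem_cands (M : Multiset (Finset ℝ)) (n : ℕ) (x : ℝ) (p : Finset ℝ)
    (i : ℕ) (hi : i < (mwChainAux M n x p).length) :
    (mwChainAux M n x p).getD i ∅ ∈ cands M (x - i) ((p :: mwChainAux M n x p).getD i ∅) := by
  induction n generalizing x p i with
  | zero => simp [mwChainAux] at hi
  | succ n ih =>
    by_cases h : (cands M x p).Nonempty
    · rw [mwChainAux, if_pos h] at hi ⊢
      cases i with
      | zero => simpa using chooseMin_mem h
      | succ i =>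
        have := ih (x - 1) (chooseMin (cands M x p)) i (by simpa using hi)
        rw [List.getD_cons_succ, List.getD_cons_succ]
        convert this using 2
        push_cast
        ring
    · simp [mwChainAux, h] at hi

/-- As long as there is a candidate and fuel is left, the chain goes on, with a shortest
candidate. -/
theorem mwChainAux_continue {M : Multiset (Finset ℝ)} {n : ℕ} {x : ℝ} {p S : Finset ℝ} {i : ℕ}
    (hi : i ≤ (mwChainAux M n x p).length) (hn : i < n)
    (hS : S ∈ cands M (x - i) ((p :: mwChainAux M n x p).getD i ∅)) :
    i < (mwChainAux M n x p).length ∧ ((mwChainAux M n x p).getD i ∅).card ≤ S.card := by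
  induction n generalizing x p i with
  | zero => omega
  | succ n ih =>
    by_cases h : (cands M x p).Nonempty
    · rw [mwChainAux, if_pos h] at hi hS ⊢
      cases i with
      | zero =>
        have hS' : S ∈ cands M x p := by simpa using hS
        simpa using card_chooseMin_le hS'
      | succ i =>
        rw [List.getD_cons_succ] at hS ⊢
        have hx : x - ((i + 1 : ℕ) : ℝ) = x - 1 - i := by push_cast; ring
        rw [hx] at hS
        simpa using ih (by simpa using hi) (by omega) hS
    · rw [mwChainAux, if_neg h] at hi hS
      obtain rfl : i = 0 := by simpa using hi
      exact absurd ⟨S, by simpa using hS⟩ h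

/-- The members of `M⁻`. -/
theorem mem_msMinus {M : Multiset (Finset ℝ)} {T : Finset ℝ} (hT : T ∈ msMinus M) :
    T ∈ M ∨ ∃ δ ∈ mwChain M, segMinus δ ≠ ∅ ∧ T = segMinus δ := by
  have aux : ∀ (l : List (Finset ℝ)) (N : Multiset (Finset ℝ)),
      T ∈ l.foldl
        (fun N δ => if segMinus δ = ∅ then N.erase δ else segMinus δ ::ₘ N.erase δ) N →
      T ∈ N ∨ ∃ δ ∈ l, segMinus δ ≠ ∅ ∧ T = segMinus δ := by
    intro l
    induction l with
    | nil => exact fun N h => Or.inl h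
    | cons d l ih =>
      intro N h
      rcases ih _ h with h | ⟨δ, hδ, h⟩
      · dsimp only at h
        split_ifs at h with hd
        · exact Or.inl (Multiset.mem_of_mem_erase h)
        · rcases Multiset.mem_cons.1 h with h | h
          · exact Or.inr ⟨d, List.mem_cons_self, hd, h⟩
          · exact Or.inl (Multiset.mem_of_mem_erase h)
      · exact Or.inr ⟨δ, List.mem_cons_of_mem _ hδ, h⟩
  exact aux _ _ hT

/-- A ladder of `n` segments of `M` from `e`: the endings are `e, e - 1, ..., e - n + 1`, and
no segment is included in the preceding one. -/
def IsLadder (M : Multiset (Finset ℝ)) (e : ℝ) (n : ℕ) (f : ℕ → Finset ℝ) : Prop :=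
  (∀ i < n, f i ∈ M ∧ endg (f i) = e - i) ∧ ∀ i, i + 1 < n → ¬ f (i + 1) ⊆ f i

theorem length_le_card_of_endg_eq {M : Multiset (Finset ℝ)} {e : ℝ} {n : ℕ} {f : ℕ → Finset ℝ}
    (h : ∀ i < n, f i ∈ M ∧ endg (f i) = e - i) : n ≤ Multiset.card M := by
  have hinj : Set.InjOn f (Finset.range n) := by
    intro i hi j hj hij
    have h1 := (h i (by simpa using hi)).2
    rw [hij, (h j (by simpa using hj)).2] at h1
    exact_mod_cast (sub_right_injective h1).symm
  calc n = ((Finset.range n).image f).card := by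
        rw [Finset.card_image_of_injOn hinj, Finset.card_range]
    _ ≤ M.toFinset.card := by
        refine Finset.card_le_card fun S hS => ?_
        obtain ⟨i, hi, rfl⟩ := Finset.mem_image.1 hS
        exact Multiset.mem_toFinset.2 (h i (Finset.mem_range.1 hi)).1
    _ ≤ Multiset.card M := Multiset.toFinset_card_le M

theorem isLadder_mwChain (M : Multiset (Finset ℝ)) :
    IsLadder M (maxEnd M) (mwChain M).length (fun i => (mwChain M).getD i ∅) := by
  have h := mwChainAux_getD_mem_cands M (Multiset.card M) (maxEnd M) ∅
  refine ⟨fun i hi => ?_, fun i hi => ?_⟩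
  · have := mem_cands.1 (h i hi)
    exact ⟨this.1, this.2.1⟩
  · exact (mem_cands.1 (h (i + 1) hi)).2.2

theorem IsLadder.mono {M : Multiset (Finset ℝ)} {e : ℝ} {m n : ℕ} {f : ℕ → Finset ℝ}
    (h : IsLadder M e n f) (hmn : m ≤ n) : IsLadder M e m f :=
  ⟨fun i hi => h.1 i (hi.trans_le hmn), fun i hi => h.2 i (hi.trans_le hmn)⟩

theorem mem_mwChain {M : Multiset (Finset ℝ)} {δ : Finset ℝ} (hδ : δ ∈ mwChain M) :
    ∃ i < (mwChain M).length, δ = (mwChain M).getD i ∅ ∧ δ ∈ M ∧ endg δ = maxEnd M - i := by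
  obtain ⟨i, hi, rfl⟩ := List.mem_iff_getElem.1 hδ
  have h := (isLadder_mwChain M).1 i hi
  simp only [List.getD_eq_getElem _ _ hi] at h
  exact ⟨i, hi, (List.getD_eq_getElem _ _ hi).symm, h⟩

theorem endg_le_maxEnd {M : Multiset (Finset ℝ)} {S : Finset ℝ} (hS : S ∈ M) :
    endg S ≤ maxEnd M := by
  have h : endg S ∈ (M.map endg).toFinset :=
    Multiset.mem_toFinset.2 (Multiset.mem_map_of_mem _ hS)
  obtain ⟨y, hy⟩ := Finset.max_of_mem h
  rw [maxEnd, hy]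
  exact Finset.le_max_of_eq h hy

theorem exists_endg_eq_maxEnd {M : Multiset (Finset ℝ)} (hM : M ≠ 0) :
    ∃ S ∈ M, endg S = maxEnd M := by
  obtain ⟨S, hS⟩ := Multiset.exists_mem_of_ne_zero hM
  obtain ⟨y, hy⟩ := Finset.max_of_mem
    (Multiset.mem_toFinset.2 (Multiset.mem_map_of_mem endg hS))
  obtain ⟨T, hT, h⟩ := Multiset.mem_map.1 (Multiset.mem_toFinset.1 (Finset.mem_of_max hy))
  refine ⟨T, hT, ?_⟩
  rw [h, maxEnd, hy]
  rfl

/-- A ladder of `M⁻` from the largest ending of `M` is already a ladder of `M`. -/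
theorem IsLadder.of_msMinus {M : Multiset (Finset ℝ)} (hM : ∀ S ∈ M, IsSegment S) {n : ℕ}
    {f : ℕ → Finset ℝ} (h : IsLadder (msMinus M) (maxEnd M) n f) :
    IsLadder M (maxEnd M) n f := by
  have key : ∀ i < n, f i ∈ M ∧ i < (mwChain M).length ∧ (mwChain M).getD i ∅ ⊆ f i := by
    intro i
    induction i using Nat.strong_induction_on with
    | _ i ih =>
      intro hi
      have hend := (h.1 i hi).2
      have hfM : f i ∈ M := by
        rcases mem_msMinus (h.1 i hi).1 with hf | ⟨δ, hδ, hne, hf⟩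
        · exact hf
        exfalso
        obtain ⟨j, hj, hδj, hδM, hδe⟩ := mem_mwChain hδ
        have he := ((hM δ hδM).segMinus_spec hne).2
        rw [← hf, hend, hδe] at he
        obtain rfl : i = j + 1 := by
          have : (i : ℝ) = j + 1 := by linarith
          exact_mod_cast this
        refine h.2 j hi ?_
        rw [hf]
        refine (Finset.erase_subset _ _).trans ?_
        rw [hδj]
        exact (ih j j.lt_succ_self (by omega)).2.2
      have hcard : i + 1 ≤ Multiset.card M := by
        refine length_le_card_of_endg_eq (e := maxEnd M) (f := f) fun j hj => ?_
        rcases Nat.lt_succ_iff_lt_or_eq.1 hj with hj | rfl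
        · exact ⟨(ih j hj (by omega)).1, (h.1 j (by omega)).2⟩
        · exact ⟨hfM, hend⟩
      have hlen : i ≤ (mwChain M).length := by
        cases i with
        | zero => exact Nat.zero_le _
        | succ i => exact (ih i i.lt_succ_self (by omega)).2.1
      have hcand : f i ∈ cands M (maxEnd M - i) ((∅ :: mwChain M).getD i ∅) := by
        refine mem_cands.2 ⟨hfM, hend, ?_⟩
        cases i with
        | zero => simpa using (hM _ hfM).not_subset_empty
        | succ i =>
          exact fun hs => h.2 i hi (hs.trans (ih i i.lt_succ_self (by omega)).2.2)
      obtain ⟨hlt, hle⟩ := mwChainAux_continue hlen hcard hcand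
      have hδ := (isLadder_mwChain M).1 i hlt
      exact ⟨hfM, hlt, (hM _ hδ.1).subset_of_card_le (hM _ hfM) (hδ.2.trans hend.symm) hle⟩
  exact ⟨fun i hi => ⟨(key i hi).1, (h.1 i hi).2⟩, h.2⟩

/-- The property of multisegments that is propagated along the algorithm: the endings lie in
`{e - k, ..., e}` and there is no ladder of length `k + 1` from `e`. -/
structure LadderBounded (M : Multiset (Finset ℝ)) (k : ℕ) (e : ℝ) : Prop where
  isSegment : ∀ S ∈ M, IsSegment S
  endg_eq : ∀ S ∈ M, ∃ j ≤ k, endg S = e - (j : ℕ)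
  not_isLadder : ∀ f, ¬ IsLadder M e (k + 1) f

namespace LadderBounded

theorem of_endings {M : Multiset (Finset ℝ)} {k : ℕ} {e : ℝ} (hM : ∀ S ∈ M, IsSegment S)
    (hE : ∀ S ∈ M, ∃ j < k, endg S = e - (j : ℕ)) : LadderBounded M k e where
  isSegment := hM
  endg_eq S hS := (hE S hS).imp fun _ h => ⟨h.1.le, h.2⟩
  not_isLadder f hf := by
    obtain ⟨hk, he⟩ := hf.1 k k.lt_succ_self
    obtain ⟨j, hj, h⟩ := hE _ hk
    rw [h] at he
    exact hj.ne (by exact_mod_cast sub_right_injective he)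

theorem maxEnd {M : Multiset (Finset ℝ)} {k : ℕ} {e : ℝ} (h : LadderBounded M k e)
    (hM : M ≠ 0) : LadderBounded M k (maxEnd M) := by
  obtain ⟨T, hT, hTe⟩ := exists_endg_eq_maxEnd hM
  obtain ⟨t, ht, hTt⟩ := h.endg_eq T hT
  rcases Nat.eq_zero_or_pos t with rfl | hpos
  · have : _root_.maxEnd M = e := by rw [← hTe, hTt]; simp
    rwa [this]
  · refine of_endings h.isSegment fun S hS => ?_
    obtain ⟨j, hj, hSj⟩ := h.endg_eq S hS
    have hle := endg_le_maxEnd hS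
    rw [← hTe, hTt, hSj] at hle
    have htj : t ≤ j := by
      have : (t : ℝ) ≤ j := by linarith
      exact_mod_cast this
    refine ⟨j - t, by omega, ?_⟩
    rw [hSj, ← hTe, hTt, Nat.cast_sub htj]
    ring

theorem length_mwChain_le {M : Multiset (Finset ℝ)} {k : ℕ}
    (h : LadderBounded M k (_root_.maxEnd M)) : (mwChain M).length ≤ k := by
  by_contra! hlt
  exact h.not_isLadder _ ((isLadder_mwChain M).mono hlt)

theorem msMinus {M : Multiset (Finset ℝ)} {k : ℕ} (h : LadderBounded M k (_root_.maxEnd M)) :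
    LadderBounded (msMinus M) k (_root_.maxEnd M) where
  isSegment S hS := by
    rcases mem_msMinus hS with hS | ⟨δ, hδ, hne, rfl⟩
    · exact h.isSegment S hS
    · obtain ⟨-, -, -, hδM, -⟩ := mem_mwChain hδ
      exact ((h.isSegment δ hδM).segMinus_spec hne).1
  endg_eq S hS := by
    rcases mem_msMinus hS with hS | ⟨δ, hδ, hne, rfl⟩
    · exact h.endg_eq S hS
    · obtain ⟨i, hi, -, hδM, hδe⟩ := mem_mwChain hδ
      refine ⟨i + 1, hi.trans_le h.length_mwChain_le, ?_⟩
      rw [((h.isSegment δ hδM).segMinus_spec hne).2, hδe]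
      push_cast
      ring
  not_isLadder f hf := h.not_isLadder f (hf.of_msMinus h.isSegment)

theorem card_le_of_mem_mwaAux {M : Multiset (Finset ℝ)} {k : ℕ} {e : ℝ}
    (h : LadderBounded M k e) (n : ℕ) : ∀ S ∈ mwaAux n M, S.card ≤ k := by
  induction n generalizing M e with
  | zero => simp [mwaAux]
  | succ n ih =>
    intro S hS
    rw [mwaAux] at hS
    split_ifs at hS with hM
    · simp at hS
    · have h' := h.maxEnd hM
      rcases Multiset.mem_cons.1 hS with rfl | hS
      · rw [firstSeg, card_finsetSeg]
        exact h'.length_mwChain_le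
      · exact ih h'.msMinus S hS

end LadderBounded

/-- Property (P): if every element of `E(M)` belongs to some segment of length `k`,
then every segment of `M^#` has length at most `k`, i.e. `m(M^#) ≤ k`. -/
theorem mwa_maxLen_le_of_endings_in_segment (M : Multiset (Finset ℝ))
    (hM : IsMultisegment M) (k : ℕ) (hk : 1 ≤ k)
    (hE : ∃ a : ℝ, ∀ S ∈ M, endg S ∈ finsetSeg a k) :
    maxLen (mwa M) ≤ k := by
  obtain ⟨a, ha⟩ := hE
  have h : LadderBounded M k (a + k - 1) := by
    refine LadderBounded.of_endings hM.2 fun S hS => ?_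
    obtain ⟨i, hi, hai⟩ := mem_finsetSeg.1 (ha S hS)
    refine ⟨k - (i + 1), by omega, ?_⟩
    rw [← hai, Nat.cast_sub hi]
    push_cast
    ring
  refine Multiset.sup_le.2 fun c hc => ?_
  obtain ⟨S, hS, rfl⟩ := Multiset.mem_map.1 hc
  exact h.card_le_of_mem_mwaAux _ S hS
end
end

section
/- Property (P'): for every multisegment M, the maxlength of M^# is at most the thickness of M, i.e., m(M^#) ≤ t(M). -/
open scoped Classical

noncomputable section

theorem chooseMin_cands_spec {M : Multiset (Finset ℝ)} {x : ℝ} {prev : Finset ℝ}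
    (h : (cands M x prev).Nonempty) :
    chooseMin (cands M x prev) ∈ M ∧ endg (chooseMin (cands M x prev)) = x := by
  have hmem := chooseMin_mem h
  have hspec := (Finset.mem_filter.1 hmem)
  exact ⟨Multiset.mem_toFinset.1 hspec.1, hspec.2.1⟩

theorem length_mwChainAux_le (M : Multiset (Finset ℝ)) (n : ℕ) (x : ℝ) (prev : Finset ℝ) :
    (mwChainAux M n x prev).length ≤ n := by
  induction n generalizing x prev with
  | zero => simp [mwChainAux]
  | succ n ih =>
    rw [mwChainAux]
    split_ifs
    · simpa using ih _ _
    · simp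

theorem mem_and_endg_le_of_mem_mwChainAux {M : Multiset (Finset ℝ)} {n : ℕ} {x : ℝ}
    {prev δ : Finset ℝ} (hδ : δ ∈ mwChainAux M n x prev) : δ ∈ M ∧ endg δ ≤ x := by
  induction n generalizing x prev with
  | zero => simp [mwChainAux] at hδ
  | succ n ih =>
    rw [mwChainAux] at hδ
    split_ifs at hδ with h
    · rcases List.mem_cons.1 hδ with rfl | hδ
      · exact ⟨(chooseMin_cands_spec h).1, (chooseMin_cands_spec h).2.le⟩
      · exact ⟨(ih hδ).1, by linarith [(ih hδ).2]⟩
    · simp at hδ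

theorem nodup_mwChainAux (M : Multiset (Finset ℝ)) (n : ℕ) (x : ℝ) (prev : Finset ℝ) :
    (mwChainAux M n x prev).Nodup := by
  induction n generalizing x prev with
  | zero => simp [mwChainAux]
  | succ n ih =>
    rw [mwChainAux]
    split_ifs with h
    · refine List.nodup_cons.2 ⟨fun hmem => ?_, ih _ _⟩
      have hle := (mem_and_endg_le_of_mem_mwChainAux hmem).2
      rw [(chooseMin_cands_spec h).2] at hle
      linarith
    · simp

theorem card_foldl_segMinus_le (L : List (Finset ℝ)) (N : Multiset (Finset ℝ))
    (hL : L.Nodup) (hmem : ∀ δ ∈ L, δ ∈ N) :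
    Multiset.card (L.foldl
      (fun N δ => if segMinus δ = ∅ then N.erase δ else segMinus δ ::ₘ N.erase δ) N) ≤
      Multiset.card N := by
  induction L generalizing N with
  | nil => simp
  | cons δ L ih =>
    obtain ⟨hδ, hL⟩ := List.nodup_cons.1 hL
    have hstay : ∀ γ ∈ L, γ ∈ N.erase δ := fun γ hγ =>
      (Multiset.mem_erase_of_ne (ne_of_mem_of_not_mem hγ hδ)).2
        (hmem γ (List.mem_cons_of_mem _ hγ))
    have hcard := Multiset.card_erase_add_one (hmem δ List.mem_cons_self)
    rw [List.foldl_cons]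
    split_ifs
    · exact (ih _ hL hstay).trans (by omega)
    · refine (ih _ hL fun γ hγ => Multiset.mem_cons_of_mem (hstay γ hγ)).trans ?_
      rw [Multiset.card_cons, hcard]

theorem card_msMinus_le (M : Multiset (Finset ℝ)) :
    Multiset.card (msMinus M) ≤ Multiset.card M :=
  card_foldl_segMinus_le _ _ (nodup_mwChainAux _ _ _ _)
    fun _ h => (mem_and_endg_le_of_mem_mwChainAux h).1

theorem card_finsetSeg_le (a : ℝ) (m : ℕ) : (finsetSeg a m).card ≤ m := by
  refine Finset.card_image_le.trans ?_
  simpa using Finset.card_image_le (s := Finset.range m) (f := fun i : ℕ => (i : ℝ))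

theorem card_firstSeg_le (M : Multiset (Finset ℝ)) :
    (firstSeg M).card ≤ Multiset.card M :=
  (card_finsetSeg_le _ _).trans (length_mwChainAux_le _ _ _ _)

theorem card_le_of_mem_mwaAux {n : ℕ} {M : Multiset (Finset ℝ)} {S : Finset ℝ}
    (hS : S ∈ mwaAux n M) : S.card ≤ Multiset.card M := by
  induction n generalizing M with
  | zero => simp [mwaAux] at hS
  | succ n ih =>
    rw [mwaAux] at hS
    split_ifs at hS
    · simp at hS
    · rcases Multiset.mem_cons.1 hS with rfl | hS
      · exact card_firstSeg_le M
      · exact (ih hS).trans (card_msMinus_le M)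

/-- Property (P'): the maxlength of `M^#` is at most the thickness of `M`,
i.e. `m(M^#) ≤ t(M)`. -/
theorem mwa_maxLen_le_thickness (M : Multiset (Finset ℝ))
    (hM : IsMultisegment M) :
    maxLen (mwa M) ≤ thickness M := by
  refine Multiset.sup_le.2 fun k hk => ?_
  obtain ⟨S, hS, rfl⟩ := Multiset.mem_map.1 hk
  exact card_le_of_mem_mwaAux hS
end
end

section
/- A staircase multisegment is determined by its support among multisegments of bounded thickness and maxlength: let a ∈ ℝ and let l, k ≥ 1 be integers. If M is a multisegment with t(M) ≤ l, m(M) ≤ k, and supp(M) = supp(M(a; k, l)) as multisets, then M = M(a; k, l). -/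
open scoped Classical

noncomputable section

theorem finsetSeg_eq_image (a : ℝ) (m : ℕ) :
    finsetSeg a m = (Finset.range m).image fun i : ℕ => a + (i : ℝ) := by
  ext x
  simp [finsetSeg, Finset.bind_def, Finset.pure_def, eq_neg_add_iff_add_eq]

theorem finsetSeg_val (a : ℝ) (m : ℕ) :
    (finsetSeg a m).val = (Multiset.range m).map fun i : ℕ => a + (i : ℝ) := by
  rw [finsetSeg_eq_image, Finset.image_val_of_injOn fun i _ j _ h => by simpa using h]
  rfl

theorem suppM_cons (S : Finset ℝ) (M : Multiset (Finset ℝ)) :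
    suppM (S ::ₘ M) = S.val + suppM M := by
  simp [suppM]

theorem card_suppM (M : Multiset (Finset ℝ)) :
    Multiset.card (suppM M) = (M.map Finset.card).sum := by
  induction M using Multiset.induction with
  | empty => simp [suppM]
  | cons S M ih => simp [suppM_cons, ih]

theorem count_finsetSeg_add (b x : ℝ) (k : ℕ) :
    (finsetSeg b k).val.count x + ({b} : Multiset ℝ).count (x - k) =
      (finsetSeg b k).val.count (x - 1) + ({b} : Multiset ℝ).count x := by
  simp only [finsetSeg_val]
  induction k with
  | zero => simp
  | succ n ih =>
    have h₁ : x = b + n ↔ x - n = b := sub_eq_iff_eq_add.symm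
    have h₂ : x - 1 = b + n ↔ x - (n + 1) = b := by
      constructor <;> intro h <;> linarith
    simp only [Multiset.range_succ, Multiset.map_cons, Multiset.count_cons,
      Multiset.count_singleton, Nat.cast_succ, h₁, h₂] at ih ⊢
    omega

theorem count_suppM_map_finsetSeg_add (B : Multiset ℝ) (x : ℝ) (k : ℕ) :
    (suppM (B.map (finsetSeg · k))).count x + B.count (x - k) =
      (suppM (B.map (finsetSeg · k))).count (x - 1) + B.count x := by
  induction B using Multiset.induction with
  | empty => simp [suppM]
  | cons b B ih =>
    have h := count_finsetSeg_add b x k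
    rw [Multiset.map_cons, suppM_cons, ← Multiset.singleton_add b B]
    simp only [Multiset.count_add]
    omega

/-- A multisegment all of whose segments have length `k ≥ 1` is determined by its support. -/
theorem suppM_map_finsetSeg_injective {k : ℕ} (hk : 1 ≤ k) :
    Function.Injective fun B : Multiset ℝ => suppM (B.map (finsetSeg · k)) := by
  intro B C h
  replace h : suppM (B.map (finsetSeg · k)) = suppM (C.map (finsetSeg · k)) := h
  set F := (B + C).toFinset.filter fun x => B.count x ≠ C.count x with hF
  have mem_F : ∀ x, x ∈ F ↔ B.count x ≠ C.count x := by
    intro x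
    simp only [hF, Finset.mem_filter, Multiset.mem_toFinset, Multiset.mem_add,
      and_iff_right_iff_imp]
    contrapose!
    rintro ⟨hB, hC⟩
    rw [Multiset.count_eq_zero_of_notMem hB, Multiset.count_eq_zero_of_notMem hC]
  rcases F.eq_empty_or_nonempty with h_empty | h_ne
  · ext x
    by_contra hx
    exact Finset.notMem_empty x (h_empty ▸ (mem_F x).2 hx)
  · have h_min := (mem_F _).1 (F.min'_mem h_ne)
    have h_shift : F.min' h_ne - k ∈ F := by
      rw [mem_F]
      have hB := count_suppM_map_finsetSeg_add B (F.min' h_ne) k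
      have hC := count_suppM_map_finsetSeg_add C (F.min' h_ne) k
      rw [h] at hB
      omega
    have h_le := F.min'_le _ h_shift
    have h_pos : (1 : ℝ) ≤ k := by exact_mod_cast hk
    linarith

theorem staircase_eq_map (a : ℝ) (l k : ℕ) :
    staircase a l k = ((Multiset.range k).map fun i : ℕ => a + i + 1).map (finsetSeg · l) := by
  simp [staircase]

theorem sum_card_staircase (a : ℝ) (l k : ℕ) :
    ((staircase a l k).map Finset.card).sum = k * l := by
  simp [staircase, card_finsetSeg]

theorem card_eq_of_le_sum {M : Multiset (Finset ℝ)} {l k : ℕ} (ht : thickness M ≤ l)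
    (hm : maxLen M ≤ k) (hsum : l * k ≤ (M.map Finset.card).sum) :
    ∀ S ∈ M, S.card = k := by
  have h_le : ∀ S ∈ M, S.card ≤ k := fun S hS =>
    (Multiset.le_sup (Multiset.mem_map_of_mem _ hS)).trans hm
  intro S hS
  by_contra h_ne
  have h_lt : (M.map Finset.card).sum < (M.map fun _ => k).sum :=
    Multiset.sum_lt_sum h_le ⟨S, hS, lt_of_le_of_ne (h_le S hS) h_ne⟩
  rw [Multiset.map_const', Multiset.sum_replicate, smul_eq_mul] at h_lt
  exact absurd (h_lt.trans_le (Nat.mul_le_mul_right k ht)) hsum.not_gt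

theorem exists_eq_map_finsetSeg {M : Multiset (Finset ℝ)} {k : ℕ}
    (hM : ∀ S ∈ M, IsSegment S) (hcard : ∀ S ∈ M, S.card = k) :
    ∃ B : Multiset ℝ, M = B.map (finsetSeg · k) := by
  have h : ∀ S, ∃ b : ℝ, S ∈ M → finsetSeg b k = S := by
    intro S
    by_cases hS : S ∈ M
    · obtain ⟨b, m, -, rfl⟩ := hM S hS
      have h_eq := hcard _ hS
      rw [card_finsetSeg] at h_eq
      exact ⟨b, fun _ => by rw [h_eq]⟩
    · exact ⟨0, fun h => absurd h hS⟩
  choose b hb using h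
  refine ⟨M.map b, ?_⟩
  rw [Multiset.map_map]
  conv_lhs => rw [← Multiset.map_id M]
  exact Multiset.map_congr rfl fun S hS => (hb S hS).symm

/-- A staircase multisegment is determined by its support among multisegments of bounded
thickness and maxlength: if `t(M) ≤ l`, `m(M) ≤ k` and `supp(M) = supp(M(a; k, l))`,
then `M = M(a; k, l)`. -/
theorem staircase_determined_by_support (a : ℝ) (l k : ℕ) (hl : 1 ≤ l) (hk : 1 ≤ k)
    (M : Multiset (Finset ℝ)) (hM : IsMultisegment M)
    (ht : thickness M ≤ l) (hm : maxLen M ≤ k)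
    (hsupp : suppM M = suppM (staircase a k l)) :
    M = staircase a k l := by
  have hsum : l * k ≤ (M.map Finset.card).sum := by
    rw [← card_suppM, hsupp, card_suppM, sum_card_staircase]
  obtain ⟨B, rfl⟩ := exists_eq_map_finsetSeg hM.2 (card_eq_of_le_sum ht hm hsum)
  rw [staircase_eq_map] at hsupp ⊢
  exact congrArg _ (suppM_map_finsetSeg_injective hk hsupp)
end
end
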